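/- arXiv:0909.4577 — 2 statements merged into one kernel-verified Lean document; each statement's English description precedes it below -/
import Mathlib

section
/- Let n ≥ 5 and let G be a connected graph on n vertices whose cycles are exactly two cycles sharing at least one common edge (i.e., G ∈ 𝔹₃(n), so G is bicyclic with two cycles having at least one edge in common). Then χ(G) ≤ (n−4)/2 + 1/√6 + 4/√5, with equality if and only if G is obtained from the cycle C_n by adding an edge; moreover, if G is not of that form, then χ(G) ≤ (n−5)/2 + 6/√5, with equality if and only if G is obtained by joining two non-adjacent vertices of a cycle C_a with 4 ≤ a ≤ n−1 by a path of length n − a + 1. -/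
open SimpleGraph

/-- The degree of a vertex (stated via `Set.ncard`, so no decidability assumptions). -/
noncomputable def degR {V : Type*} (G : SimpleGraph V) (v : V) : ℕ :=
  (G.neighborSet v).ncard

/-- The sum-connectivity index `χ(G) = ∑_{uv ∈ E(G)} 1/√(d_G(u)+d_G(v))`. -/
noncomputable def sumConn {V : Type*} [Fintype V] (G : SimpleGraph V) : ℝ :=
  ∑ e ∈ G.edgeSet.toFinite.toFinset,
    Sym2.lift ⟨fun u v => (1 : ℝ) / Real.sqrt ((degR G u : ℝ) + (degR G v : ℝ)),
      fun u v => by simp [add_comm]⟩ e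

/-- Two vertex-disjoint cycles `C_a` and `C_b` joined by an edge. -/
def twoCyclesEdge (a b : ℕ) : SimpleGraph (Fin a ⊕ Fin b) :=
  SimpleGraph.fromRel (fun x y =>
    (∃ i j, x = Sum.inl i ∧ y = Sum.inl j ∧ (SimpleGraph.cycleGraph a).Adj i j) ∨
    (∃ i j, x = Sum.inr i ∧ y = Sum.inr j ∧ (SimpleGraph.cycleGraph b).Adj i j) ∨
    (∃ (ha : 0 < a) (hb : 0 < b), x = Sum.inl ⟨0, ha⟩ ∧ y = Sum.inr ⟨0, hb⟩))

/-- Two vertex-disjoint cycles `C_a` and `C_b` joined by a path with `k ≥ 1` internal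
vertices, i.e. a path of length `k + 1`. -/
def twoCyclesPath (a b k : ℕ) : SimpleGraph ((Fin a ⊕ Fin b) ⊕ Fin k) :=
  SimpleGraph.fromRel (fun x y =>
    (∃ i j, x = Sum.inl (Sum.inl i) ∧ y = Sum.inl (Sum.inl j) ∧
      (SimpleGraph.cycleGraph a).Adj i j) ∨
    (∃ i j, x = Sum.inl (Sum.inr i) ∧ y = Sum.inl (Sum.inr j) ∧
      (SimpleGraph.cycleGraph b).Adj i j) ∨
    (∃ (ha : 0 < a) (hk : 0 < k), x = Sum.inl (Sum.inl ⟨0, ha⟩) ∧ y = Sum.inr ⟨0, hk⟩) ∨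
    (∃ i j : Fin k, x = Sum.inr i ∧ y = Sum.inr j ∧ (j : ℕ) = (i : ℕ) + 1) ∨
    (∃ (hb : 0 < b) (hk : 0 < k),
      x = Sum.inr ⟨k - 1, Nat.sub_lt hk Nat.one_pos⟩ ∧ y = Sum.inl (Sum.inr ⟨0, hb⟩)))

/-- The cycle `C_a` together with a path with `k ≥ 1` internal vertices (i.e. a path of
length `k + 1`) joining the vertices `x` and `y` of the cycle. -/
def cyclePlusPath (a k : ℕ) (x y : Fin a) : SimpleGraph (Fin a ⊕ Fin k) :=
  SimpleGraph.fromRel (fun z w =>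
    (∃ i j, z = Sum.inl i ∧ w = Sum.inl j ∧ (SimpleGraph.cycleGraph a).Adj i j) ∨
    (∃ hk : 0 < k, z = Sum.inl x ∧ w = Sum.inr ⟨0, hk⟩) ∨
    (∃ i j : Fin k, z = Sum.inr i ∧ w = Sum.inr j ∧ (j : ℕ) = (i : ℕ) + 1) ∨
    (∃ hk : 0 < k, z = Sum.inr ⟨k - 1, Nat.sub_lt hk Nat.one_pos⟩ ∧ w = Sum.inl y))

/-- `G` belongs to the family `B₁⁽¹⁾(n)`: it is obtained by joining two vertex-disjoint
cycles `C_a` and `C_b` with `a + b = n` by an edge. -/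
def IsB1a {V : Type*} (n : ℕ) (G : SimpleGraph V) : Prop :=
  ∃ a b : ℕ, 3 ≤ a ∧ 3 ≤ b ∧ a + b = n ∧ Nonempty (G ≃g twoCyclesEdge a b)

/-- `G` belongs to the family `B₁⁽²⁾(n)`: it is obtained by joining two vertex-disjoint
cycles `C_a` and `C_b` with `a + b < n` by a path of length `n - a - b + 1`. -/
def IsB1b {V : Type*} (n : ℕ) (G : SimpleGraph V) : Prop :=
  ∃ a b : ℕ, 3 ≤ a ∧ 3 ≤ b ∧ a + b < n ∧ Nonempty (G ≃g twoCyclesPath a b (n - a - b))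

/-- `G` belongs to the family `B₃⁽¹⁾(n)`: it is obtained from the cycle `C_n` by adding
an edge (between two distinct non-adjacent vertices). -/
def IsB3a {V : Type*} (n : ℕ) (G : SimpleGraph V) : Prop :=
  ∃ x y : Fin n, x ≠ y ∧ ¬ (SimpleGraph.cycleGraph n).Adj x y ∧
    Nonempty (G ≃g (SimpleGraph.cycleGraph n ⊔ SimpleGraph.fromEdgeSet {s(x, y)}))

/-- `G` belongs to the family `B₃⁽²⁾(n)`: it is obtained by joining two non-adjacent
vertices of a cycle `C_a` with `4 ≤ a ≤ n - 1` by a path of length `n - a + 1`. -/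
def IsB3b {V : Type*} (n : ℕ) (G : SimpleGraph V) : Prop :=
  ∃ (a : ℕ) (x y : Fin a), 4 ≤ a ∧ a ≤ n - 1 ∧ x ≠ y ∧
    ¬ (SimpleGraph.cycleGraph a).Adj x y ∧ Nonempty (G ≃g cyclePlusPath a (n - a) x y)


section EdgeSums

variable {V : Type*} [Fintype V] {G : SimpleGraph V}

open Classical in
lemma card_filter_mem_edge (G : SimpleGraph V) (v : V) :
    (G.edgeSet.toFinite.toFinset.filter (fun e => v ∈ e)).card = degR G v := by
  have h : Nat.card (G.incidenceSet v) = Nat.card (G.neighborSet v) :=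
    Nat.card_congr (G.incidenceSetEquivNeighborSet v)
  rw [degR, ← Nat.card_coe_set_eq, ← h, Nat.card_coe_set_eq, ← Set.ncard_coe_finset]
  congr 1
  ext e
  simp [SimpleGraph.incidenceSet]

open Classical in
lemma sum_edges_add (G : SimpleGraph V) (g : V → ℝ) (w : Sym2 V → ℝ)
    (hw : ∀ u v, G.Adj u v → w s(u, v) = g u + g v) :
    ∑ e ∈ G.edgeSet.toFinite.toFinset, w e = ∑ v, (degR G v : ℝ) * g v := by
  have h1 : ∀ e ∈ G.edgeSet.toFinite.toFinset,
      w e = ∑ v, if v ∈ e then g v else 0 := by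
    intro e he
    induction e with
    | h u v =>
      have huv : G.Adj u v := by simpa using he
      rw [hw u v huv, ← Finset.sum_filter]
      have : (Finset.univ.filter (fun a => a ∈ s(u, v))) = {u, v} := by
        ext a; simp
      rw [this, Finset.sum_pair huv.ne]
  rw [Finset.sum_congr rfl h1, Finset.sum_comm]
  refine Finset.sum_congr rfl fun v _ => ?_
  rw [← Finset.sum_filter, Finset.sum_const, card_filter_mem_edge, nsmul_eq_mul]

lemma card_edges (G : SimpleGraph V) :
    G.edgeSet.toFinite.toFinset.card = G.edgeSet.ncard := by
  rw [Set.ncard_eq_toFinset_card]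

lemma sum_degR (G : SimpleGraph V) : ∑ v, degR G v = 2 * G.edgeSet.ncard := by
  have h := sum_edges_add G (fun _ => 1) (fun _ => 2) (fun _ _ _ => by norm_num)
  rw [Finset.sum_const, card_edges] at h
  have : ((∑ v, degR G v : ℕ) : ℝ) = ((2 * G.edgeSet.ncard : ℕ) : ℝ) := by
    push_cast
    simp at h
    linarith
  exact_mod_cast this

/-- The weight of an edge in the sum-connectivity index. -/
noncomputable def edgeWeight {V : Type*} (G : SimpleGraph V) (e : Sym2 V) : ℝ :=
  Sym2.lift ⟨fun u v => (1 : ℝ) / Real.sqrt ((degR G u : ℝ) + (degR G v : ℝ)),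
    fun u v => by simp [add_comm]⟩ e

omit [Fintype V] in
lemma edgeWeight_mk (u v : V) :
    edgeWeight G s(u, v) = 1 / Real.sqrt ((degR G u : ℝ) + (degR G v : ℝ)) := rfl

lemma sumConn_eq : sumConn G = ∑ e ∈ G.edgeSet.toFinite.toFinset, edgeWeight G e := rfl

/-- The sum of the reciprocal degrees of the two ends of an edge. -/
noncomputable def invDegSum {V : Type*} (G : SimpleGraph V) (e : Sym2 V) : ℝ :=
  Sym2.lift ⟨fun u v => ((degR G u : ℝ))⁻¹ + ((degR G v : ℝ))⁻¹, fun u v => by simp [add_comm]⟩ e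

lemma sum_invDegSum (hpos : ∀ v, degR G v ≠ 0) :
    ∑ e ∈ G.edgeSet.toFinite.toFinset, invDegSum G e = Fintype.card V := by
  rw [sum_edges_add G (fun v => ((degR G v : ℝ))⁻¹) _ (fun _ _ _ => rfl)]
  have : ∀ v ∈ Finset.univ, (degR G v : ℝ) * ((degR G v : ℝ))⁻¹ = 1 := fun v _ =>
    mul_inv_cancel₀ (by exact_mod_cast hpos v)
  rw [Finset.sum_congr rfl this]
  simp

/-- The function whose sum over the edges measures how far the index is from its linear part. -/
noncomputable def excess {V : Type*} (G : SimpleGraph V) (e : Sym2 V) : ℝ :=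
  edgeWeight G e - 27 / 100 * invDegSum G e - 23 / 100

lemma sumConn_eq_excess (hpos : ∀ v, degR G v ≠ 0)
    (hedges : G.edgeSet.ncard = Fintype.card V + 1) :
    sumConn G = (Fintype.card V : ℝ) / 2 + 23 / 100 +
      ∑ e ∈ G.edgeSet.toFinite.toFinset, excess G e := by
  simp only [excess, Finset.sum_sub_distrib, ← Finset.mul_sum, sum_invDegSum hpos,
    Finset.sum_const, card_edges, hedges, sumConn_eq, nsmul_eq_mul]
  push_cast
  ring

lemma invSqrt_le {s q : ℝ} (hq : 0 < q) (h : 1 ≤ q ^ 2 * s) : 1 / Real.sqrt s ≤ q := by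
  have hs : 0 < s := by
    by_contra hs
    nlinarith [sq_nonneg q]
  rw [div_le_iff₀ (Real.sqrt_pos.2 hs), ← Real.sqrt_sq hq.le, ← Real.sqrt_mul (by positivity)]
  exact Real.one_le_sqrt.2 h

lemma invSqrt_add_le (a b : ℕ) (ha : 1 ≤ a) (hb : 1 ≤ b) (hab : 3 ≤ a + b) :
    1 / Real.sqrt ((a : ℝ) + b) ≤ 27 / 100 * ((a : ℝ)⁻¹ + (b : ℝ)⁻¹) + 23 / 100 := by
  rcases Nat.lt_or_ge (a + b) 6 with h | h
  · have ha' : a ≤ 4 := by omega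
    have hb' : b ≤ 4 := by omega
    apply invSqrt_le
    · positivity
    · interval_cases a <;> interval_cases b <;> first | omega | norm_num
  · have hs : (6 : ℝ) ≤ (a : ℝ) + b := by exact_mod_cast h
    have ha0 : (0 : ℝ) < a := by exact_mod_cast ha
    have hb0 : (0 : ℝ) < b := by exact_mod_cast hb
    set t := 1 / Real.sqrt ((a : ℝ) + b) with ht
    have ht2 : t ^ 2 = 1 / ((a : ℝ) + b) := by
      rw [ht, div_pow, Real.sq_sqrt (by linarith), one_pow]
    have h1 : t ≤ 425 / 1000 := invSqrt_le (by norm_num) (by nlinarith)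
    have h2 : 4 * t ^ 2 ≤ (a : ℝ)⁻¹ + (b : ℝ)⁻¹ := by
      rw [ht2, inv_add_inv ha0.ne' hb0.ne', mul_one_div, div_le_div_iff₀ (by positivity)
        (by positivity)]
      nlinarith [sq_nonneg ((a : ℝ) - b)]
    nlinarith [mul_nonneg (sub_nonneg.2 h1) (by linarith : (0:ℝ) ≤ 1/2 - t)]

omit [Fintype V] in
lemma excess_nonpos (u v : V) (hu : degR G u ≠ 0) (hv : degR G v ≠ 0)
    (h : 3 ≤ degR G u + degR G v) : excess G s(u, v) ≤ 0 := by
  have := invSqrt_add_le (degR G u) (degR G v) (by omega) (by omega) h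
  simp only [excess, edgeWeight_mk, invDegSum, Sym2.lift_mk]
  linarith

lemma le_invSqrt {s q : ℝ} (hq : 0 < q) (hs : 0 < s) (h : q ^ 2 * s ≤ 1) :
    q ≤ 1 / Real.sqrt s := by
  rw [le_div_iff₀ (Real.sqrt_pos.2 hs), ← Real.sqrt_sq hq.le, ← Real.sqrt_mul (by positivity)]
  exact Real.sqrt_le_one.2 h

omit [Fintype V] in
lemma excess_leaf (u v : V) (hu : degR G u = 1) (hv : 2 ≤ degR G v) :
    excess G s(u, v) ≤ - 1 / 20 := by
  simp only [excess, edgeWeight_mk, invDegSum, Sym2.lift_mk, hu]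
  generalize degR G v = b at hv
  rcases (by omega : b = 2 ∨ b = 3 ∨ 4 ≤ b) with rfl | rfl | hb
  · have : 1 / Real.sqrt (((1 : ℕ) : ℝ) + ((2 : ℕ) : ℝ)) ≤ 578 / 1000 :=
      invSqrt_le (by norm_num) (by norm_num)
    norm_num at this ⊢
    linarith
  · have : 1 / Real.sqrt (((1 : ℕ) : ℝ) + ((3 : ℕ) : ℝ)) ≤ 1 / 2 :=
      invSqrt_le (by norm_num) (by norm_num)
    norm_num at this ⊢
  · have hb' : (4 : ℝ) ≤ b := by exact_mod_cast hb
    have : 1 / Real.sqrt (((1 : ℕ) : ℝ) + (b : ℝ)) ≤ 45 / 100 :=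
      invSqrt_le (by norm_num) (by push_cast; nlinarith)
    have h2 : (0 : ℝ) ≤ (b : ℝ)⁻¹ := by positivity
    push_cast at this ⊢
    linarith

omit [Fintype V] in
lemma excess_four_two (u v : V) (hu : degR G u = 4) (hv : degR G v = 2) :
    excess G s(u, v) ≤ - 1 / 50 := by
  simp only [excess, edgeWeight_mk, invDegSum, Sym2.lift_mk, hu, hv]
  have : 1 / Real.sqrt (((4 : ℕ) : ℝ) + ((2 : ℕ) : ℝ)) ≤ 4084 / 10000 :=
    invSqrt_le (by norm_num) (by norm_num)
  norm_num at this ⊢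
  linarith

lemma lower_bound_six_div_sqrt_five (n : ℝ) :
    n / 2 + 18 / 100 < (n - 5) / 2 + 6 / Real.sqrt 5 := by
  have : 4472 / 10000 ≤ 1 / Real.sqrt 5 := le_invSqrt (by norm_num) (by norm_num) (by norm_num)
  have h : 6 / Real.sqrt 5 = 6 * (1 / Real.sqrt 5) := by ring
  rw [h]
  linarith

lemma nonadjacent_bound_lt_adjacent_bound (n : ℝ) :
    (n - 5) / 2 + 6 / Real.sqrt 5 < (n - 4) / 2 + 1 / Real.sqrt 6 + 4 / Real.sqrt 5 := by
  have h5 : 1 / Real.sqrt 5 ≤ 4473 / 10000 := invSqrt_le (by norm_num) (by norm_num)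
  have h6 : 408 / 1000 ≤ 1 / Real.sqrt 6 := le_invSqrt (by norm_num) (by norm_num) (by norm_num)
  have e1 : 6 / Real.sqrt 5 = 6 * (1 / Real.sqrt 5) := by ring
  have e2 : 4 / Real.sqrt 5 = 4 * (1 / Real.sqrt 5) := by ring
  rw [e1, e2]
  linarith

lemma degR_pos_of_connected (hconn : G.Connected) (hn : 2 ≤ Fintype.card V) (v : V) :
    degR G v ≠ 0 := by
  have : Nontrivial V := Fintype.one_lt_card_iff_nontrivial.1 hn
  obtain ⟨w, hw⟩ := hconn.preconnected.exists_adj_of_nontrivial v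
  exact Set.ncard_ne_zero_of_mem hw

open Classical in
lemma sum_excess_le (v : V) (c : ℝ) (hall : ∀ u w, G.Adj u w → excess G s(u, w) ≤ 0)
    (hv : ∀ u, G.Adj v u → excess G s(v, u) ≤ c) :
    ∑ e ∈ G.edgeSet.toFinite.toFinset, excess G e ≤ degR G v * c := by
  have h := sum_edges_add G (fun u => if u = v then c else 0)
    (fun e => Sym2.lift ⟨fun u w => (if u = v then c else 0) + (if w = v then c else 0),
      fun u w => add_comm _ _⟩ e) (fun _ _ _ => rfl)
  simp only [mul_ite, mul_zero, Finset.sum_ite_eq', Finset.mem_univ, if_true] at h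
  rw [← h]
  refine Finset.sum_le_sum fun e he => ?_
  induction e with
  | h u w =>
    have huw : G.Adj u w := by simpa using he
    simp only [Sym2.lift_mk]
    by_cases h1 : u = v
    · subst h1
      simpa [huw.ne'] using hv w huw
    · by_cases h2 : w = v
      · subst h2
        rw [Sym2.eq_swap]
        simpa [h1] using hv u huw.symm
      · simpa [h1, h2] using hall u w huw

lemma sum_degR_sub_two (hge : ∀ v, 2 ≤ degR G v)
    (hedges : G.edgeSet.ncard = Fintype.card V + 1) : ∑ v, (degR G v - 2) = 2 := by
  have h := sum_degR G
  have h2 : ∑ v, degR G v = ∑ v, ((degR G v - 2) + 2) :=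
    Finset.sum_congr rfl fun v _ => by have := hge v; omega
  rw [h2, Finset.sum_add_distrib, Finset.sum_const, Finset.card_univ, smul_eq_mul] at h
  omega

/-- The degrees of a graph of minimum degree two with one more edge than vertices. -/
lemma degR_cases (hge : ∀ v, 2 ≤ degR G v) (hedges : G.edgeSet.ncard = Fintype.card V + 1) :
    (∃ x, degR G x = 4 ∧ ∀ v, v ≠ x → degR G v = 2) ∨
    (∃ x y, x ≠ y ∧ degR G x = 3 ∧ degR G y = 3 ∧ ∀ v, v ≠ x → v ≠ y → degR G v = 2) := by
  classical
  have h := sum_degR_sub_two hge hedges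
  obtain ⟨x, -, hx⟩ := Finset.exists_ne_zero_of_sum_ne_zero (h.trans_ne two_ne_zero)
  rw [← Finset.add_sum_erase _ _ (Finset.mem_univ x)] at h
  by_cases hr : ∑ v ∈ Finset.univ.erase x, (degR G v - 2) = 0
  · left
    refine ⟨x, by omega, fun v hv => ?_⟩
    have := (Finset.sum_eq_zero_iff.1 hr) v (by simp [hv])
    have := hge v
    omega
  · right
    obtain ⟨y, hy, hy'⟩ := Finset.exists_ne_zero_of_sum_ne_zero hr
    rw [← Finset.add_sum_erase _ _ hy] at h
    have hr' : ∑ v ∈ (Finset.univ.erase x).erase y, (degR G v - 2) = 0 := by omega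
    refine ⟨x, y, (Finset.ne_of_mem_erase hy).symm, by omega, by omega, fun v hv hv' => ?_⟩
    have := (Finset.sum_eq_zero_iff.1 hr') v (by simp [hv, hv'])
    have := hge v
    omega

lemma degR_eq_of_three_le (hge : ∀ v, 2 ≤ degR G v)
    (hedges : G.edgeSet.ncard = Fintype.card V + 1) {x y : V} (hxy : x ≠ y)
    (hx : 3 ≤ degR G x) (hy : 3 ≤ degR G y) :
    degR G x = 3 ∧ degR G y = 3 ∧ ∀ v, v ≠ x → v ≠ y → degR G v = 2 := by
  rcases degR_cases hge hedges with ⟨a, ha, h⟩ | ⟨a, b, hab, ha, hb, h⟩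
  · have hxa : x = a := by
      by_contra hne
      have := h x hne
      omega
    have := h y (fun hne => hxy (hxa.trans hne.symm))
    omega
  · have hx' : x = a ∨ x = b := by
      by_contra! hne
      have := h x hne.1 hne.2
      omega
    have hy' : y = a ∨ y = b := by
      by_contra! hne
      have := h y hne.1 hne.2
      omega
    rcases hx' with rfl | rfl <;> rcases hy' with rfl | rfl
    · exact absurd rfl hxy
    · exact ⟨ha, hb, h⟩
    · exact ⟨hb, ha, fun v h1 h2 => h v h2 h1⟩
    · exact absurd rfl hxy

/-- A leaf of a connected graph with at least three vertices is not adjacent to a leaf. -/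
lemma two_le_degR_of_adj_leaf (hconn : G.Connected) (hn : 3 ≤ Fintype.card V) {u v : V}
    (huv : G.Adj u v) (hu : degR G u = 1) : 2 ≤ degR G v := by
  classical
  by_contra hv
  have hv1 : degR G v = 1 := by
    have := degR_pos_of_connected hconn (by omega) v
    omega
  obtain ⟨a, ha⟩ := Set.ncard_eq_one.1 hu
  obtain ⟨b, hb⟩ := Set.ncard_eq_one.1 hv1
  have ha' : v = a := by
    have : v ∈ G.neighborSet u := huv
    rwa [ha] at this
  have hb' : u = b := by
    have : u ∈ G.neighborSet v := huv.symm
    rwa [hb] at this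
  obtain ⟨w, hw⟩ : ∃ w, w ∉ ({u, v} : Finset V) := by
    by_contra! h
    have := Finset.card_le_card (fun x _ => h x : Finset.univ ⊆ ({u, v} : Finset V))
    have := Finset.card_le_two (a := u) (b := v)
    rw [Finset.card_univ] at *
    omega
  obtain ⟨p⟩ := hconn.preconnected u w
  obtain ⟨d, -, hd1, hd2⟩ := p.exists_boundary_dart {u, v} (by simp) (by simpa using hw)
  have had := d.adj
  rcases hd1 with h1 | h1
  · have : d.snd ∈ G.neighborSet u := h1 ▸ had
    rw [ha] at this
    exact hd2 (Or.inr (this.trans ha'.symm))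
  · have : d.snd ∈ G.neighborSet v := h1 ▸ had
    rw [hb] at this
    exact hd2 (Or.inl (this.trans hb'.symm))

lemma sumConn_lt_of_leaf (hconn : G.Connected) (hn : 3 ≤ Fintype.card V)
    (hedges : G.edgeSet.ncard = Fintype.card V + 1) {v : V} (hv : degR G v = 1) :
    sumConn G < ((Fintype.card V : ℝ) - 5) / 2 + 6 / Real.sqrt 5 := by
  have hpos := degR_pos_of_connected hconn (by omega)
  have h := sum_excess_le (G := G) v (-1 / 20) (fun u w huw => ?_)
    (fun u hu => excess_leaf v u hv (two_le_degR_of_adj_leaf hconn hn hu hv))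
  · rw [hv] at h
    have := lower_bound_six_div_sqrt_five (Fintype.card V)
    rw [sumConn_eq_excess hpos hedges]
    push_cast at h
    linarith
  · refine excess_nonpos u w (hpos u) (hpos w) ?_
    by_cases h1 : degR G u = 1
    · have := two_le_degR_of_adj_leaf hconn hn huw h1
      omega
    · have := hpos u
      have := hpos w
      omega

lemma sumConn_lt_of_degR_four (hedges : G.edgeSet.ncard = Fintype.card V + 1) {x : V}
    (hx : degR G x = 4) (h2 : ∀ v, v ≠ x → degR G v = 2) :
    sumConn G < ((Fintype.card V : ℝ) - 5) / 2 + 6 / Real.sqrt 5 := by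
  have hge : ∀ v, 2 ≤ degR G v := fun v => by
    by_cases hv : v = x
    · rw [hv]; omega
    · exact (h2 v hv).ge
  have hpos : ∀ v, degR G v ≠ 0 := fun v => by have := hge v; omega
  have h := sum_excess_le (G := G) x (-1 / 50)
    (fun u w _ => excess_nonpos u w (hpos u) (hpos w) (by have := hge u; have := hge w; omega))
    (fun u hu => excess_four_two x u hx (h2 u hu.ne'))
  rw [hx] at h
  have := lower_bound_six_div_sqrt_five (Fintype.card V)
  rw [sumConn_eq_excess hpos hedges]
  push_cast at h
  linarith

open Classical in
lemma sumConn_of_two_cubic (hedges : G.edgeSet.ncard = Fintype.card V + 1) {x y : V}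
    (hxy : x ≠ y) (hx : degR G x = 3) (hy : degR G y = 3)
    (h2 : ∀ v, v ≠ x → v ≠ y → degR G v = 2) :
    sumConn G = ((Fintype.card V : ℝ) - 5) / 2 + 6 / Real.sqrt 5 +
      if G.Adj x y then 1 / 2 + 1 / Real.sqrt 6 - 2 / Real.sqrt 5 else 0 := by
  set c : ℝ := 1 / Real.sqrt 5 - 1 / 2 with hc
  set d : ℝ := 1 / 2 + 1 / Real.sqrt 6 - 2 / Real.sqrt 5 with hd
  have h4 : (1 : ℝ) / Real.sqrt (2 + 2) = 1 / 2 := by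
    rw [show (2 + 2 : ℝ) = 2 ^ 2 by norm_num, Real.sqrt_sq (by norm_num)]
  have h := sum_edges_add G (fun v => if v = x ∨ v = y then c else 0)
    (fun e => edgeWeight G e - 1 / 2 - if e = s(x, y) then d else 0) ?_
  · rw [Finset.sum_sub_distrib, Finset.sum_sub_distrib, ← sumConn_eq, Finset.sum_const,
      card_edges, hedges, Finset.sum_ite_eq'] at h
    have hs : ∑ v, (degR G v : ℝ) * (if v = x ∨ v = y then c else 0) = 6 * c := by
      have : ∀ v, (degR G v : ℝ) * (if v = x ∨ v = y then c else 0) =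
          if v ∈ ({x, y} : Finset V) then 3 * c else 0 := by
        intro v
        by_cases h1 : v = x
        · subst h1; simp [hx]
        · by_cases h2 : v = y
          · subst h2; simp [hy]
          · simp [h1, h2]
      simp only [this]
      rw [Finset.sum_ite_mem, Finset.univ_inter, Finset.sum_pair hxy]
      ring
    rw [hs] at h
    simp only [Set.Finite.mem_toFinset, SimpleGraph.mem_edgeSet, nsmul_eq_mul] at h
    push_cast at h
    have e6 : 6 / Real.sqrt 5 = 6 * (1 / Real.sqrt 5) := by ring
    rw [e6]
    linarith
  · intro u v huv
    have hne := huv.ne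
    rw [edgeWeight_mk]
    have e2 : 2 / Real.sqrt 5 = 2 * (1 / Real.sqrt 5) := by ring
    have e5 : (2 + 3 : ℝ) = 5 := by norm_num
    have e5' : (3 + 2 : ℝ) = 5 := by norm_num
    have e6 : (3 + 3 : ℝ) = 6 := by norm_num
    have hdeg : ∀ v, (degR G v : ℝ) = if v = x ∨ v = y then 3 else 2 := by
      intro v
      by_cases h1 : v = x
      · subst h1; simp [hx]
      · by_cases h3 : v = y
        · subst h3; simp [hy]
        · simp [h1, h3, h2 v h1 h3]
    rw [hdeg u, hdeg v]
    by_cases hux : u = x <;> by_cases huy : u = y <;> by_cases hvx : v = x <;>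
      by_cases hvy : v = y <;>
      simp only [hux, huy, hvx, hvy, hxy, Ne, Sym2.eq_iff, or_true, or_false, if_true,
        if_false, and_true, and_false, e5, e5', e6, h4, hxy.symm, not_true,
        or_self] at * <;>
      first | contradiction | linarith

end EdgeSums

section LongestPaths

variable {V : Type*} {G : SimpleGraph V} {f : ℕ → V} {m : ℕ}

/-- The vertices `f 0, …, f m` form a path of `G`. -/
def IsPathMap (G : SimpleGraph V) (f : ℕ → V) (m : ℕ) : Prop :=
  (∀ s t, s ≤ m → t ≤ m → f s = f t → s = t) ∧ ∀ t, t < m → G.Adj (f t) (f (t + 1))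

/-- The vertices `f 0, …, f m` form a path of `G` of maximal length. -/
def IsLongestPathMap (G : SimpleGraph V) (f : ℕ → V) (m : ℕ) : Prop :=
  IsPathMap G f m ∧ ∀ g k, IsPathMap G g k → k ≤ m

lemma IsPathMap.reverse (h : IsPathMap G f m) : IsPathMap G (fun t => f (m - t)) m := by
  refine ⟨fun s t hs ht hst => ?_, fun t ht => ?_⟩
  · have := h.1 _ _ (by omega) (by omega) hst
    omega
  · have := h.2 (m - (t + 1)) (by omega)
    rw [show m - (t + 1) + 1 = m - t by omega] at this
    exact this.symm

lemma IsPathMap.rotate (h : IsPathMap G f m) {j : ℕ} (hjm : j ≤ m)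
    (hadj : G.Adj (f 0) (f j)) :
    IsPathMap G (fun t => if t < j then f (j - 1 - t) else f t) m := by
  refine ⟨fun s t hs ht hst => ?_, fun t ht => ?_⟩
  · dsimp only at hst
    split_ifs at hst with h1 h2 h2
    · have := h.1 _ _ (by omega) (by omega) hst
      omega
    · have := h.1 _ _ (by omega) (by omega) hst
      omega
    · have := h.1 _ _ (by omega) (by omega) hst
      omega
    · exact h.1 _ _ hs ht hst
  · dsimp only
    split_ifs with h1 h2 h2
    · have := h.2 (j - 1 - (t + 1)) (by omega)
      rw [show j - 1 - (t + 1) + 1 = j - 1 - t by omega] at this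
      exact this.symm
    · rw [show j - 1 - t = 0 by omega, show t + 1 = j by omega]
      exact hadj
    · omega
    · exact h.2 t ht

lemma IsPathMap.cons (h : IsPathMap G f m) {z : V} (hz : ∀ t, t ≤ m → z ≠ f t)
    (hadj : G.Adj z (f 0)) :
    IsPathMap G (fun t => if t = 0 then z else f (t - 1)) (m + 1) := by
  refine ⟨fun s t hs ht hst => ?_, fun t ht => ?_⟩
  · dsimp only at hst
    split_ifs at hst with h1 h2 h2
    · omega
    · exact absurd hst (hz _ (by omega))
    · exact absurd hst.symm (hz _ (by omega))
    · have := h.1 _ _ (by omega) (by omega) hst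
      omega
  · dsimp only
    rw [if_neg (by omega : ¬ t + 1 = 0)]
    split_ifs with h1
    · rw [h1]; exact hadj
    · have := h.2 (t - 1) (by omega)
      rwa [show t - 1 + 1 = t by omega] at this

lemma IsPathMap.shift (h : IsPathMap G f m) (hadj : G.Adj (f m) (f 0)) {k : ℕ} (hk : k ≤ m) :
    IsPathMap G (fun t => if t + k ≤ m then f (t + k) else f (t + k - m - 1)) m := by
  refine ⟨fun s t hs ht hst => ?_, fun t ht => ?_⟩
  · dsimp only at hst
    split_ifs at hst with h1 h2 h2 <;>
      · have := h.1 _ _ (by omega) (by omega) hst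
        omega
  · dsimp only
    split_ifs with h1 h2 h2
    · rw [show t + 1 + k = t + k + 1 by omega]
      exact h.2 _ (by omega)
    · rw [show t + k = m by omega, show t + 1 + k - m - 1 = 0 by omega]
      exact hadj
    · omega
    · rw [show t + 1 + k - m - 1 = t + k - m - 1 + 1 by omega]
      exact h.2 _ (by omega)

lemma IsLongestPathMap.exists_eq_of_adj (h : IsLongestPathMap G f m) {z : V}
    (hadj : G.Adj (f 0) z) : ∃ t, t ≤ m ∧ z = f t := by
  by_contra! hz
  have := h.2 _ _ (h.1.cons hz hadj.symm)
  omega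

lemma exists_isLongestPathMap [Fintype V] [Nonempty V] (G : SimpleGraph V) :
    ∃ f m, IsLongestPathMap G f m := by
  classical
  let P : ℕ → Prop := fun m => ∃ f, IsPathMap G f m
  have hP0 : P 0 := ⟨fun _ => Classical.arbitrary V, fun s t hs ht _ => by omega,
    fun t ht => by omega⟩
  have hb : ∀ f k, IsPathMap G f k → k ≤ Fintype.card V := by
    intro f k hk
    have := Fintype.card_le_of_injective (fun t : Fin (k + 1) => f t)
      (fun s t hst => Fin.ext (hk.1 _ _ (by omega) (by omega) hst))
    simp at this
    omega
  obtain ⟨f, hf⟩ := Nat.findGreatest_spec (P := P) (Nat.zero_le (Fintype.card V)) hP0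
  exact ⟨f, _, hf, fun g k hg => Nat.le_findGreatest (hb g k hg) ⟨g, hg⟩⟩

lemma exists_eq_of_closed (hconn : G.Connected)
    (hcl : ∀ s z, s ≤ m → G.Adj (f s) z → ∃ t, t ≤ m ∧ z = f t) (z : V) :
    ∃ t, t ≤ m ∧ z = f t := by
  by_contra hz
  obtain ⟨p⟩ := hconn.preconnected (f 0) z
  obtain ⟨d, -, ⟨t, ht, hd1⟩, hd2⟩ := p.exists_boundary_dart {w | ∃ t, t ≤ m ∧ w = f t}
    ⟨0, by omega, rfl⟩ hz
  exact hd2 (hcl t _ ht (hd1 ▸ d.adj))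

lemma IsLongestPathMap.exists_eq_of_cyclic (h : IsLongestPathMap G f m) (hconn : G.Connected)
    (hadj : G.Adj (f m) (f 0)) (z : V) : ∃ t, t ≤ m ∧ z = f t := by
  refine exists_eq_of_closed hconn (fun s z hs hsz => ?_) z
  have h' : IsLongestPathMap G _ m := ⟨h.1.shift hadj hs, h.2⟩
  obtain ⟨t, ht, rfl⟩ := h'.exists_eq_of_adj (z := z) (by simpa [hs] using hsz)
  split_ifs with h1
  · exact ⟨_, h1, rfl⟩
  · exact ⟨_, by omega, rfl⟩

section Degrees

variable [Fintype V]

lemma adj_iff_of_degR_two {v a b : V} (hv : degR G v = 2) (ha : G.Adj v a) (hb : G.Adj v b)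
    (hab : a ≠ b) (z : V) : G.Adj v z ↔ z = a ∨ z = b := by
  have h : ({a, b} : Set V) = G.neighborSet v := by
    refine Set.eq_of_subset_of_ncard_le ?_ ?_ (Set.toFinite _)
    · rintro w (rfl | rfl)
      exacts [ha, hb]
    · rw [Set.ncard_pair hab]
      exact hv.le
  rw [← mem_neighborSet, ← h]
  rfl

lemma adj_iff_of_degR_three {v a b c : V} (hv : degR G v = 3) (ha : G.Adj v a) (hb : G.Adj v b)
    (hc : G.Adj v c) (hab : a ≠ b) (hac : a ≠ c) (hbc : b ≠ c) (z : V) :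
    G.Adj v z ↔ z = a ∨ z = b ∨ z = c := by
  have h : ({a, b, c} : Set V) = G.neighborSet v := by
    refine Set.eq_of_subset_of_ncard_le ?_ ?_ (Set.toFinite _)
    · rintro w (rfl | rfl | rfl)
      exacts [ha, hb, hc]
    · rw [Set.ncard_eq_three.2 ⟨a, b, c, hab, hac, hbc, rfl⟩]
      exact hv.le
  rw [← mem_neighborSet, ← h]
  rfl

lemma exists_adj_notMem {v : V} (s : Finset V) (hv : s.card < degR G v) :
    ∃ z, G.Adj v z ∧ z ∉ s := by
  rw [← Set.ncard_coe_finset] at hv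
  obtain ⟨z, hz, hzs⟩ := Set.exists_mem_notMem_of_ncard_lt_ncard hv
  exact ⟨z, hz, by simpa using hzs⟩

lemma card_le_degR {v : V} (s : Finset V) (hs : ∀ z ∈ s, G.Adj v z) : s.card ≤ degR G v := by
  rw [← Set.ncard_coe_finset]
  exact Set.ncard_le_ncard (fun z hz => hs z (by simpa using hz)) (Set.toFinite _)

lemma three_le_degR {v a b c : V} (ha : G.Adj v a) (hb : G.Adj v b) (hc : G.Adj v c)
    (hab : a ≠ b) (hac : a ≠ c) (hbc : b ≠ c) : 3 ≤ degR G v := by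
  classical
  rw [← Finset.card_eq_three.2 ⟨a, b, c, hab, hac, hbc, rfl⟩]
  exact card_le_degR _ (by simp [ha, hb, hc])

lemma two_le_degR {v a b : V} (ha : G.Adj v a) (hb : G.Adj v b) (hab : a ≠ b) :
    2 ≤ degR G v := by
  classical
  rw [← Finset.card_pair hab]
  exact card_le_degR _ (by simp [ha, hb])

lemma IsLongestPathMap.two_le (h : IsLongestPathMap G f m) (hge : ∀ v, 2 ≤ degR G v) : 2 ≤ m := by
  classical
  by_contra hm
  obtain ⟨z, hz, hz'⟩ := exists_adj_notMem (G := G) {f 1} (hge (f 0))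
  obtain ⟨t, ht, rfl⟩ := h.exists_eq_of_adj hz
  have h0 : t ≠ 0 := fun h0 => hz.ne (by rw [h0])
  have h1 : t ≠ 1 := fun h1 => hz' (by simp [h1])
  omega

/-- A longest path can be rotated so that its first vertex has degree two. -/
lemma IsLongestPathMap.exists_head_degR_two (h : IsLongestPathMap G f m)
    (hge : ∀ v, 2 ≤ degR G v) {x y : V} (h2 : ∀ v, v ≠ x → v ≠ y → degR G v = 2) :
    ∃ g, IsLongestPathMap G g m ∧ g m = f m ∧ degR G (g 0) = 2 := by
  classical
  by_cases hd : degR G (f 0) = 2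
  · exact ⟨f, h, rfl, hd⟩
  have hd3 : 3 ≤ degR G (f 0) := by have := hge (f 0); omega
  have hm := h.two_le hge
  obtain ⟨z, hz, hz'⟩ := exists_adj_notMem (G := G) (v := f 0) {f 1} (by simp; omega)
  obtain ⟨w, hw, hw'⟩ := exists_adj_notMem (G := G) (v := f 0) {f 1, z}
    (lt_of_le_of_lt Finset.card_le_two (by omega))
  obtain ⟨j, hj, rfl⟩ := h.exists_eq_of_adj hz
  obtain ⟨k, hk, rfl⟩ := h.exists_eq_of_adj hw
  have hj0 : j ≠ 0 := fun h0 => hz.ne (by rw [h0])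
  have hj1 : j ≠ 1 := fun h1 => hz' (by simp [h1])
  have hk0 : k ≠ 0 := fun h0 => hw.ne (by rw [h0])
  have hk1 : k ≠ 1 := fun h1 => hw' (by simp [h1])
  have hkj : k ≠ j := fun h1 => hw' (by simp [h1])
  have key : ∀ l, 2 ≤ l → l ≤ m → G.Adj (f 0) (f l) → degR G (f (l - 1)) = 2 →
      ∃ g, IsLongestPathMap G g m ∧ g m = f m ∧ degR G (g 0) = 2 := by
    intro l hl hlm hadj hdeg
    refine ⟨_, ⟨h.1.rotate hlm hadj, h.2⟩, ?_, ?_⟩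
    · simp [show ¬ m < l by omega]
    · simpa [show 0 < l by omega] using hdeg
  by_cases hdj : degR G (f (j - 1)) = 2
  · exact key j (by omega) hj hz hdj
  · refine key k (by omega) hk hw ?_
    have e1 : f 0 = x ∨ f 0 = y := by
      by_contra! hne
      exact hd (h2 _ hne.1 hne.2)
    have e2 : f (j - 1) = x ∨ f (j - 1) = y := by
      by_contra! hne
      exact hdj (h2 _ hne.1 hne.2)
    have n1 : f 0 ≠ f (j - 1) := fun he => by
      have := h.1.1 _ _ (by omega) (by omega) he; omega
    have n2 : f (k - 1) ≠ f 0 := fun he => by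
      have := h.1.1 _ _ (by omega) (by omega) he; omega
    have n3 : f (k - 1) ≠ f (j - 1) := fun he => by
      have := h.1.1 _ _ (by omega) (by omega) he; omega
    apply h2 <;> rcases e1 with e1 | e1 <;> rcases e2 with e2 | e2 <;> grind

lemma exists_isLongestPathMap_ends (hne : Nonempty V) (hge : ∀ v, 2 ≤ degR G v) {x y : V}
    (h2 : ∀ v, v ≠ x → v ≠ y → degR G v = 2) :
    ∃ f m, IsLongestPathMap G f m ∧ degR G (f 0) = 2 ∧ degR G (f m) = 2 := by
  obtain ⟨f, m, hf⟩ := exists_isLongestPathMap G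
  obtain ⟨g, hg, -, hg0⟩ := hf.exists_head_degR_two hge h2
  have hr : IsLongestPathMap G (fun t => g (m - t)) m := ⟨hg.1.reverse, hg.2⟩
  obtain ⟨k, hk, hkm, hk0⟩ := hr.exists_head_degR_two hge h2
  refine ⟨k, m, hk, hk0, ?_⟩
  rw [hkm]
  simpa using hg0

end Degrees

end LongestPaths

section Cycles

variable {V : Type*} {G : SimpleGraph V}

/-- The adjacency relation of a cycle of `G`: a connected two-regular subgraph. -/
structure IsCycleRel (G : SimpleGraph V) (C : V → V → Prop) : Prop where
  symm : ∀ {v w}, C v w → C w v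
  adj : ∀ {v w}, C v w → G.Adj v w
  two : ∀ {v w}, C v w → {z | C v z}.ncard = 2
  cross : ∀ (S : Set V) {u u' v v'}, C u u' → C v v' → u ∈ S → v ∉ S →
    ∃ a b, a ∈ S ∧ b ∉ S ∧ C a b

lemma isCycleRel_toSubgraph {u : V} {c : G.Walk u u} (hc : c.IsCycle) :
    IsCycleRel G c.toSubgraph.Adj where
  symm h := h.symm
  adj h := h.adj_sub
  two h := hc.ncard_neighborSet_toSubgraph_eq_two
    (c.mem_verts_toSubgraph.1 (c.toSubgraph.edge_vert h))
  cross S a a' b b' ha hb haS hbS := by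
    classical
    have ha' : a ∈ c.support := c.mem_verts_toSubgraph.1 (c.toSubgraph.edge_vert ha)
    have hb' : b ∈ (c.rotate a ha').support := by
      rw [Walk.mem_support_rotate_iff]
      exact c.mem_verts_toSubgraph.1 (c.toSubgraph.edge_vert hb)
    obtain ⟨d, hd, hd1, hd2⟩ :=
      ((c.rotate a ha').takeUntil b hb').exists_boundary_dart S haS hbS
    refine ⟨d.fst, d.snd, hd1, hd2, ?_⟩
    rw [Walk.adj_toSubgraph_iff_mem_edges, ← (c.rotate_edges a ha').mem_iff]
    exact Walk.edges_takeUntil_subset_edges _ _ (List.mem_map_of_mem (f := Dart.edge) hd)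

variable {C : V → V → Prop}

lemma IsCycleRel.not_unique (h : IsCycleRel G C) {v w b : V} (hw : C v w)
    (hb : ∀ z, C v z → z = b) : False := by
  have h1 : {z | C v z}.ncard ≤ ({b} : Set V).ncard :=
    Set.ncard_le_ncard (fun z hz => hb z hz) (Set.toFinite _)
  rw [h.two hw, Set.ncard_singleton] at h1
  omega

lemma IsCycleRel.left_of_two (h : IsCycleRel G C) {v w a b : V} (hw : C v w)
    (hab : ∀ z, G.Adj v z → z = a ∨ z = b) : C v a := by
  by_contra ha
  exact h.not_unique hw fun z hz => (hab z (h.adj hz)).resolve_left fun hza => ha (hza ▸ hz)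

lemma IsCycleRel.eq_or_eq (h : IsCycleRel G C) {v a b c : V} (ha : C v a) (hb : C v b)
    (hc : C v c) (hab : a ≠ b) : c = a ∨ c = b := by
  have h1 : ({a, b} : Set V) = {z | C v z} := by
    refine Set.eq_of_subset_of_ncard_le ?_ ?_ (Set.finite_of_ncard_ne_zero (by rw [h.two ha]; simp))
    · rintro w (rfl | rfl)
      exacts [ha, hb]
    · rw [Set.ncard_pair hab, h.two ha]
  have : c ∈ {z | C v z} := hc
  rwa [← h1] at this

/-- The vertices of `G` are `f 0, …, f m`, and the edges are those of this path together with
`f 0 f j` and `f m f i`. -/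
structure IsPathWithChords (G : SimpleGraph V) (f : ℕ → V) (m i j : ℕ) : Prop where
  inj : ∀ s t, s ≤ m → t ≤ m → f s = f t → s = t
  surj : ∀ z, ∃ t, t ≤ m ∧ z = f t
  adj_iff : ∀ s t, s ≤ m → t ≤ m → (G.Adj (f s) (f t) ↔ t = s + 1 ∨ s = t + 1 ∨
    (s = 0 ∧ t = j) ∨ (s = j ∧ t = 0) ∨ (s = m ∧ t = i) ∨ (s = i ∧ t = m))

variable {f : ℕ → V} {m i j : ℕ}

lemma IsPathWithChords.reverse (h : IsPathWithChords G f m i j) (hi : i ≤ m) (hj : j ≤ m) :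
    IsPathWithChords G (fun t => f (m - t)) m (m - j) (m - i) where
  inj s t hs ht hst := by
    have := h.inj _ _ (by omega) (by omega) hst
    omega
  surj z := by
    obtain ⟨t, ht, rfl⟩ := h.surj z
    exact ⟨m - t, by omega, by simp [show m - (m - t) = t by omega]⟩
  adj_iff s t hs ht := by
    rw [h.adj_iff _ _ (by omega) (by omega)]
    omega

lemma IsPathWithChords.exists_of_adj (h : IsPathWithChords G f m i j) {s : ℕ} (hs : s ≤ m) {z : V}
    (hz : G.Adj (f s) z) : ∃ t, t ≤ m ∧ z = f t ∧ (t = s + 1 ∨ s = t + 1 ∨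
    (s = 0 ∧ t = j) ∨ (s = j ∧ t = 0) ∨ (s = m ∧ t = i) ∨ (s = i ∧ t = m)) := by
  obtain ⟨t, ht, rfl⟩ := h.surj z
  exact ⟨t, ht, rfl, (h.adj_iff s t hs ht).1 hz⟩

lemma IsCycleRel.not_middle (hC : IsCycleRel G C) (h : IsPathWithChords G f m i j)
    (hj : 2 ≤ j) (hji : j < i) (him : i + 2 ≤ m) :
    (∀ k, j ≤ k → k < i → ¬ C (f k) (f (k + 1))) ∧
      ∀ k, k < j → (C (f k) (f (k + 1)) ↔ C (f 0) (f j)) := by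
  have hleft : ∀ k, k < j → (C (f k) (f (k + 1)) ↔ C (f 0) (f j)) := by
    intro k
    induction k with
    | zero =>
      intro _
      have hn : ∀ z, G.Adj (f 0) z → z = f 1 ∨ z = f j := by
        intro z hz
        obtain ⟨t, -, rfl, ht⟩ := h.exists_of_adj (by omega) hz
        rcases (by omega : t = 1 ∨ t = j) with rfl | rfl <;> simp
      exact ⟨fun hc => hC.left_of_two hc fun z hz => (hn z hz).symm,
        fun hc => hC.left_of_two hc hn⟩
    | succ k ih =>
      intro hk
      rw [← ih (by omega)]
      have hn : ∀ z, G.Adj (f (k + 1)) z → z = f k ∨ z = f (k + 1 + 1) := by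
        intro z hz
        obtain ⟨t, -, rfl, ht⟩ := h.exists_of_adj (by omega) hz
        rcases (by omega : t = k ∨ t = k + 1 + 1) with rfl | rfl <;> simp
      exact ⟨fun hc => hC.symm (hC.left_of_two hc hn),
        fun hc => hC.left_of_two (hC.symm hc) fun z hz => (hn z hz).symm⟩
  refine ⟨fun k hjk => ?_, hleft⟩
  induction k, hjk using Nat.le_induction with
  | base =>
    intro _ hc
    have hl := hleft (j - 1) (by omega)
    rw [show j - 1 + 1 = j by omega] at hl
    by_cases hd : C (f 0) (f j)
    · have := hC.eq_or_eq (hC.symm hd) (hC.symm (hl.2 hd)) hc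
        (fun he => by have := h.inj _ _ (by omega) (by omega) he; omega)
      rcases this with he | he <;>
        · have := h.inj _ _ (by omega) (by omega) he
          omega
    · refine hC.not_unique hc (b := f (j + 1)) fun z hz => ?_
      obtain ⟨t, -, rfl, ht⟩ := h.exists_of_adj (by omega) (hC.adj hz)
      rcases (by omega : t = j + 1 ∨ t = j - 1 ∨ t = 0) with rfl | rfl | rfl
      · rfl
      · exact absurd (hl.1 (hC.symm hz)) hd
      · exact absurd (hC.symm hz) hd
  | succ k hjk ih =>
    intro hk hc
    refine ih (by omega) (hC.symm (hC.left_of_two (b := f (k + 1 + 1)) hc fun z hz => ?_))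
    obtain ⟨t, -, rfl, ht⟩ := h.exists_of_adj (by omega) hz
    rcases (by omega : t = k ∨ t = k + 1 + 1) with rfl | rfl <;> simp

/-- A cycle meeting the left loop of a dumbbell is that loop. -/
lemma IsCycleRel.iff_of_left (hC : IsCycleRel G C) (h : IsPathWithChords G f m i j)
    (hj : 2 ≤ j) (hji : j < i) (him : i + 2 ≤ m) {a b : ℕ} (ha : a ≤ j) (hb : b ≤ j)
    (hab : C (f a) (f b)) (s t : ℕ) (hs : s ≤ m) (ht : t ≤ m) :
    C (f s) (f t) ↔ s ≤ j ∧ t ≤ j ∧ G.Adj (f s) (f t) := by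
  obtain ⟨hmid, hleft⟩ := hC.not_middle h hj hji him
  have hd : C (f 0) (f j) := by
    rcases (h.adj_iff a b (by omega) (by omega)).1 (hC.adj hab) with
      rfl | rfl | ⟨rfl, rfl⟩ | ⟨rfl, rfl⟩ | h' | h'
    · exact (hleft a (by omega)).1 hab
    · exact (hleft b (by omega)).1 (hC.symm hab)
    · exact hab
    · exact hC.symm hab
    · omega
    · omega
  have hside : ∀ u v, u ≤ m → v ≤ m → C (f u) (f v) → u ≤ j := by
    intro u v hu hv huv
    by_contra huj
    obtain ⟨p, q, ⟨p', hp', rfl⟩, hq, hpq⟩ := hC.cross {w | ∃ t, t ≤ j ∧ w = f t} hd huv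
      ⟨0, by omega, rfl⟩ (by
        rintro ⟨t, ht, he⟩
        have := h.inj _ _ hu (by omega) he
        omega)
    obtain ⟨q', hq'm, rfl⟩ := h.surj q
    have hq'j : ¬ q' ≤ j := fun hle => hq ⟨q', hle, rfl⟩
    have := (h.adj_iff p' q' (by omega) hq'm).1 (hC.adj hpq)
    obtain ⟨rfl, rfl⟩ : p' = j ∧ q' = j + 1 := by omega
    exact hmid _ le_rfl hji hpq
  constructor
  · intro hst
    exact ⟨hside s t hs ht hst, hside t s ht hs (hC.symm hst), hC.adj hst⟩
  · rintro ⟨hsj, htj, hst⟩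
    rcases (h.adj_iff s t hs ht).1 hst with rfl | rfl | ⟨rfl, rfl⟩ | ⟨rfl, rfl⟩ | h' | h'
    · exact (hleft s (by omega)).2 hd
    · exact hC.symm ((hleft t (by omega)).2 hd)
    · exact hd
    · exact hC.symm hd
    · omega
    · omega

/-- Two cycles of a dumbbell that share an edge coincide. -/
lemma IsCycleRel.eq_of_dumbbell {C' : V → V → Prop} (hC : IsCycleRel G C) (hC' : IsCycleRel G C')
    (h : IsPathWithChords G f m i j) (hj : 2 ≤ j) (hji : j < i) (him : i + 2 ≤ m) {v w : V}
    (hvw : C v w) (hvw' : C' v w) (a b : V) : C a b ↔ C' a b := by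
  obtain ⟨s, hs, rfl⟩ := h.surj v
  obtain ⟨t, ht, rfl⟩ := h.surj w
  obtain ⟨p, hp, rfl⟩ := h.surj a
  obtain ⟨q, hq, rfl⟩ := h.surj b
  by_cases hl : s ≤ j ∧ t ≤ j
  · rw [hC.iff_of_left h hj hji him hl.1 hl.2 hvw p q hp hq,
      hC'.iff_of_left h hj hji him hl.1 hl.2 hvw' p q hp hq]
  have hst := (h.adj_iff s t hs ht).1 (hC.adj hvw)
  by_cases hr : i ≤ s ∧ i ≤ t
  · have hrev := h.reverse (by omega) (by omega)
    have e : ∀ u, u ≤ m → m - (m - u) = u := fun u hu => by omega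
    have e1 := hC.iff_of_left hrev (a := m - s) (b := m - t) (by omega) (by omega) (by omega)
      (by omega) (by omega) (by simpa only [e s hs, e t ht] using hvw) (m - p) (m - q) (by omega)
      (by omega)
    have e2 := hC'.iff_of_left hrev (a := m - s) (b := m - t) (by omega) (by omega) (by omega)
      (by omega) (by omega) (by simpa only [e s hs, e t ht] using hvw') (m - p) (m - q) (by omega)
      (by omega)
    simp only [e p hp, e q hq] at e1 e2
    rw [e1, e2]
  · exfalso
    have hmid := (hC.not_middle h hj hji him).1
    rcases (by omega : t = s + 1 ∨ s = t + 1) with rfl | rfl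
    · exact hmid s (by omega) (by omega) hvw
    · exact hmid t (by omega) (by omega) (hC.symm hvw)

end Cycles

section Isomorphisms

variable {V : Type*} {G : SimpleGraph V} {f : ℕ → V} {m i j : ℕ}

lemma cycleGraph_adj_iff_val {n : ℕ} (hn : 3 ≤ n) (s t : Fin n) :
    (cycleGraph n).Adj s t ↔ t.val = s.val + 1 ∨ s.val = t.val + 1 ∨
      (s.val = 0 ∧ t.val + 1 = n) ∨ (t.val = 0 ∧ s.val + 1 = n) := by
  have hs := s.2
  have ht := t.2
  rw [cycleGraph_adj']
  rcases lt_trichotomy s t with h | h | h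
  · rw [Fin.coe_sub_iff_lt.2 h, Fin.coe_sub_iff_le.2 h.le]
    have : s.val < t.val := h
    omega
  · subst h
    simp only [Fin.coe_sub_iff_le.2 le_rfl]
    omega
  · rw [Fin.coe_sub_iff_lt.2 h, Fin.coe_sub_iff_le.2 h.le]
    have : t.val < s.val := h
    omega

lemma exists_iso_of_adj_iff {W : Type*} {H : SimpleGraph W} (e : W → V)
    (hinj : Function.Injective e) (hsurj : Function.Surjective e)
    (hadj : ∀ s t, G.Adj (e s) (e t) ↔ H.Adj s t) : Nonempty (G ≃g H) :=
  ⟨(⟨Equiv.ofBijective e ⟨hinj, hsurj⟩, fun {s t} => hadj s t⟩ : H ≃g G).symm⟩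

/-- Recognising a cycle with a chord. -/
lemma isB3a_of_cyclic (hm : 2 ≤ m) {p q : ℕ} (hp : p ≤ m) (hq : q ≤ m) (hpq : p ≠ q)
    (hnadj : ¬ (q = p + 1 ∨ p = q + 1 ∨ (p = 0 ∧ q = m) ∨ (q = 0 ∧ p = m)))
    (inj : ∀ s t, s ≤ m → t ≤ m → f s = f t → s = t) (surj : ∀ z, ∃ t, t ≤ m ∧ z = f t)
    (adj_iff : ∀ s t, s ≤ m → t ≤ m → (G.Adj (f s) (f t) ↔ t = s + 1 ∨ s = t + 1 ∨
      (s = 0 ∧ t = m) ∨ (t = 0 ∧ s = m) ∨ (s = p ∧ t = q) ∨ (s = q ∧ t = p))) :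
    IsB3a (m + 1) G := by
  refine ⟨⟨p, by omega⟩, ⟨q, by omega⟩, by simpa using hpq, ?_,
    exists_iso_of_adj_iff (fun t => f t) (fun s t hst => Fin.ext (inj _ _ (by omega) (by omega) hst))
      (fun z => ?_) fun s t => ?_⟩
  · rw [cycleGraph_adj_iff_val (by omega)]
    dsimp only
    omega
  · obtain ⟨t, ht, rfl⟩ := surj z
    exact ⟨⟨t, by omega⟩, rfl⟩
  · have hs := s.2
    have ht := t.2
    rw [adj_iff _ _ (by omega) (by omega), sup_adj, cycleGraph_adj_iff_val (by omega),
      fromEdgeSet_adj]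
    simp only [Set.mem_singleton_iff, Sym2.eq_iff, Fin.ext_iff, Ne]
    omega

lemma IsPathWithChords.isB3a (h : IsPathWithChords G f m i (i + 1)) (hi : 1 ≤ i)
    (him : i + 2 ≤ m) : IsB3a (m + 1) G := by
  refine isB3a_of_cyclic (f := fun t => if t ≤ i then f t else f (m + 1 + i - t)) (p := i) (q := m)
    (by omega) (by omega) le_rfl (by omega) (by omega) (fun s t hs ht hst => ?_) (fun z => ?_)
    fun s t hs ht => ?_
  · split_ifs at hst <;>
      · have := h.inj _ _ (by omega) (by omega) hst
        omega
  · obtain ⟨t, ht, rfl⟩ := h.surj z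
    by_cases hti : t ≤ i
    · exact ⟨t, ht, by simp [hti]⟩
    · refine ⟨m + 1 + i - t, by omega, ?_⟩
      rw [if_neg (by omega), show m + 1 + i - (m + 1 + i - t) = t by omega]
  · split_ifs <;> rw [h.adj_iff _ _ (by omega) (by omega)] <;> omega

lemma cyclePlusPath_adj_inl_inl {a k : ℕ} {x y s t : Fin a} :
    (cyclePlusPath a k x y).Adj (Sum.inl s) (Sum.inl t) ↔ (cycleGraph a).Adj s t := by
  simp only [cyclePlusPath, fromRel_adj]
  constructor
  · rintro ⟨-, h⟩
    simp only [Sum.inl.injEq, reduceCtorEq, false_and, and_false, exists_false, or_false] at h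
    rcases h with ⟨_, _, rfl, rfl, h⟩ | ⟨_, _, rfl, rfl, h⟩
    exacts [h, h.symm]
  · intro h
    exact ⟨by simpa using h.ne, Or.inl (Or.inl ⟨s, t, rfl, rfl, h⟩)⟩

lemma cyclePlusPath_adj_inl_inr {a k : ℕ} {x y s : Fin a} {t : Fin k} :
    (cyclePlusPath a k x y).Adj (Sum.inl s) (Sum.inr t) ↔
      (s = x ∧ t.val = 0) ∨ (s = y ∧ t.val + 1 = k) := by
  have ht := t.2
  simp only [cyclePlusPath, fromRel_adj, Sum.inl.injEq, Sum.inr.injEq, reduceCtorEq, false_and,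
    and_false, exists_false, or_false, false_or, Fin.ext_iff, exists_prop]
  constructor
  · rintro ⟨-, ⟨-, h1, h2⟩ | ⟨-, h1, h2⟩⟩
    · exact Or.inl ⟨h1, h2⟩
    · exact Or.inr ⟨h2, by omega⟩
  · rintro (⟨h1, h2⟩ | ⟨h1, h2⟩)
    · exact ⟨by simp, Or.inl ⟨by omega, h1, h2⟩⟩
    · exact ⟨by simp, Or.inr ⟨by omega, by omega, h1⟩⟩

lemma cyclePlusPath_adj_inr_inr {a k : ℕ} {x y : Fin a} {s t : Fin k} :
    (cyclePlusPath a k x y).Adj (Sum.inr s) (Sum.inr t) ↔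
      t.val = s.val + 1 ∨ s.val = t.val + 1 := by
  simp only [cyclePlusPath, fromRel_adj, Sum.inr.injEq, reduceCtorEq, false_and,
    and_false, exists_false, or_false, false_or]
  constructor
  · rintro ⟨-, ⟨_, _, rfl, rfl, h⟩ | ⟨_, _, rfl, rfl, h⟩⟩
    exacts [Or.inl h, Or.inr h]
  · rintro (h | h)
    · exact ⟨by simp [Fin.ext_iff]; omega, Or.inl ⟨s, t, rfl, rfl, h⟩⟩
    · exact ⟨by simp [Fin.ext_iff]; omega, Or.inr ⟨t, s, rfl, rfl, h⟩⟩

lemma IsPathWithChords.isB3b (h : IsPathWithChords G f m i j) (hi : 1 ≤ i) (hij : i + 2 ≤ j)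
    (hjm : j < m) : IsB3b (m + 1) G := by
  have ha : 3 ≤ m + 1 - i := by omega
  refine ⟨m + 1 - i, ⟨j - i, by omega⟩, ⟨0, by omega⟩, by omega, by omega,
    by simp [Fin.ext_iff]; omega, ?_,
    exists_iso_of_adj_iff (Sum.elim (fun t => f (i + t)) (fun t => f t)) ?_ (fun z => ?_) ?_⟩
  · rw [cycleGraph_adj_iff_val ha]
    dsimp only
    omega
  · rintro (s | s) (t | t) hst <;> simp only [Sum.elim_inl, Sum.elim_inr] at hst <;>
      have hs := s.2 <;> have ht := t.2 <;>
      have := h.inj _ _ (by omega) (by omega) hst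
    · rw [Sum.inl.injEq, Fin.ext_iff]; omega
    · omega
    · omega
    · rw [Sum.inr.injEq, Fin.ext_iff]; omega
  · obtain ⟨t, ht, rfl⟩ := h.surj z
    by_cases hti : i ≤ t
    · exact ⟨Sum.inl ⟨t - i, by omega⟩, by simp [hti]⟩
    · exact ⟨Sum.inr ⟨t, by omega⟩, rfl⟩
  · have hone : ∀ (s : Fin (m + 1 - i)) (t : Fin (m + 1 - (m + 1 - i))),
        G.Adj (f (i + s)) (f t) ↔
          (cyclePlusPath (m + 1 - i) (m + 1 - (m + 1 - i)) ⟨j - i, by omega⟩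
            ⟨0, by omega⟩).Adj (Sum.inl s) (Sum.inr t) := by
      intro s t
      have hs := s.2
      have ht := t.2
      rw [h.adj_iff _ _ (by omega) (by omega), cyclePlusPath_adj_inl_inr]
      simp only [Fin.ext_iff]
      omega
    rintro (s | s) (t | t)
    · have hs := s.2
      have ht := t.2
      simp only [Sum.elim_inl]
      rw [h.adj_iff _ _ (by omega) (by omega), cyclePlusPath_adj_inl_inl,
        cycleGraph_adj_iff_val ha]
      omega
    · exact hone s t
    · rw [adj_comm, (cyclePlusPath _ _ _ _).adj_comm]
      exact hone t s
    · have hs := s.2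
      have ht := t.2
      simp only [Sum.elim_inr]
      rw [h.adj_iff _ _ (by omega) (by omega), cyclePlusPath_adj_inr_inr]
      omega

end Isomorphisms

section Structure

variable {V : Type*} [Fintype V] {G : SimpleGraph V} {f : ℕ → V} {m : ℕ}

lemma IsLongestPathMap.isB3a_of_cyclic (h : IsLongestPathMap G f m) (hconn : G.Connected)
    (hm : 2 ≤ m) (hadj : G.Adj (f m) (f 0)) {x y : V} (hx : degR G x = 3) (hy : degR G y = 3)
    (h2 : ∀ v, v ≠ x → v ≠ y → degR G v = 2) : IsB3a (m + 1) G := by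
  classical
  have surj := h.exists_eq_of_cyclic hconn hadj
  have hne : ∀ s t, s ≤ m → t ≤ m → s ≠ t → f s ≠ f t := fun s t hs ht hst he =>
    hst (h.1.1 s t hs ht he)
  obtain ⟨succ, hsucc⟩ : ∃ succ : ℕ → ℕ, ∀ s, succ s = if s = m then 0 else s + 1 := ⟨_, fun _ => rfl⟩
  obtain ⟨pred, hpred⟩ : ∃ pred : ℕ → ℕ, ∀ s, pred s = if s = 0 then m else s - 1 := ⟨_, fun _ => rfl⟩
  have hsm : ∀ s, s ≤ m → succ s ≤ m := fun s hs => by rw [hsucc]; split_ifs <;> omega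
  have hpm : ∀ s, s ≤ m → pred s ≤ m := fun s hs => by rw [hpred]; split_ifs <;> omega
  have hsp : ∀ s, s ≤ m → succ s ≠ pred s := fun s hs => by
    rw [hsucc, hpred]; split_ifs <;> omega
  have asucc : ∀ s, s ≤ m → G.Adj (f s) (f (succ s)) := fun s hs => by
    rw [hsucc]
    split_ifs with h1
    · rw [h1]; exact hadj
    · exact h.1.2 s (by omega)
  have apred : ∀ s, s ≤ m → G.Adj (f s) (f (pred s)) := fun s hs => by
    rw [hpred]
    split_ifs with h1
    · rw [h1]; exact hadj.symm
    · have := h.1.2 (s - 1) (by omega)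
      rw [show s - 1 + 1 = s by omega] at this
      exact this.symm
  obtain ⟨p, hp, rfl⟩ := surj x
  obtain ⟨z, hz, hz'⟩ := exists_adj_notMem (G := G) (v := f p) {f (succ p), f (pred p)}
    (lt_of_le_of_lt Finset.card_le_two (by omega))
  obtain ⟨q, hq, rfl⟩ := surj z
  have hpq : p ≠ q := fun he => hz.ne (by rw [he])
  have hqs : q ≠ succ p := fun he => hz' (by simp [he])
  have hqp : q ≠ pred p := fun he => hz' (by simp [he])
  have hps : p ≠ succ q := fun he => hqp (by
    rw [hsucc] at he; rw [hpred]; split_ifs at he ⊢ <;> omega)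
  have hpp : p ≠ pred q := fun he => hqs (by
    rw [hpred] at he; rw [hsucc]; split_ifs at he ⊢ <;> omega)
  have hqy : f q = y := by
    by_contra hqy
    have := three_le_degR (asucc q hq) (apred q hq) hz.symm
      (hne _ _ (hsm q hq) (hpm q hq) (hsp q hq)) (hne _ _ (hsm q hq) hp hps.symm)
      (hne _ _ (hpm q hq) hp hpp.symm)
    rw [h2 (f q) (hne _ _ hq hp hpq.symm) hqy] at this
    omega
  subst hqy
  have hpq' : f p ≠ f q := hne _ _ hp hq hpq
  have heq : ∀ s t, s ≤ m → t ≤ m → (f t = f s ↔ t = s) := fun s t hs ht =>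
    ⟨h.1.1 t s ht hs, fun he => by rw [he]⟩
  refine _root_.isB3a_of_cyclic hm hp hq hpq ?_ h.1.1 surj fun s t hs ht => ?_
  · rw [hsucc] at hqs; rw [hpred] at hqp
    split_ifs at hqs hqp <;> omega
  · by_cases hs1 : s = p
    · subst hs1
      rw [adj_iff_of_degR_three hx (asucc s hs) (apred s hs) hz
        (hne _ _ (hsm s hs) (hpm s hs) (hsp s hs)) (hne _ _ (hsm s hs) hq hqs.symm)
        (hne _ _ (hpm s hs) hq hqp.symm), heq _ _ (hsm s hs) ht, heq _ _ (hpm s hs) ht,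
        heq _ _ hq ht, hsucc, hpred]
      split_ifs <;> omega
    · by_cases hs2 : s = q
      · subst hs2
        rw [adj_iff_of_degR_three hy (asucc s hs) (apred s hs) hz.symm
          (hne _ _ (hsm s hs) (hpm s hs) (hsp s hs)) (hne _ _ (hsm s hs) hp hps.symm)
          (hne _ _ (hpm s hs) hp hpp.symm), heq _ _ (hsm s hs) ht, heq _ _ (hpm s hs) ht,
          heq _ _ hp ht, hsucc, hpred]
        split_ifs <;> omega
      · rw [adj_iff_of_degR_two (h2 _ (hne _ _ hs hp hs1) (hne _ _ hs hq hs2)) (asucc s hs)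
          (apred s hs) (hne _ _ (hsm s hs) (hpm s hs) (hsp s hs)), heq _ _ (hsm s hs) ht,
          heq _ _ (hpm s hs) ht, hsucc, hpred]
        split_ifs <;> omega

lemma IsLongestPathMap.exists_isPathWithChords (h : IsLongestPathMap G f m)
    (hconn : G.Connected) (hm : 2 ≤ m) (hadj : ¬ G.Adj (f m) (f 0)) (h0 : degR G (f 0) = 2)
    (hfm : degR G (f m) = 2) (hle : ∀ v, degR G v ≤ 3) {x y : V}
    (h2 : ∀ v, v ≠ x → v ≠ y → degR G v = 2) :
    ∃ i j, i ≠ j ∧ 1 ≤ i ∧ i + 2 ≤ m ∧ 2 ≤ j ∧ j < m ∧ IsPathWithChords G f m i j := by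
  classical
  have hne : ∀ s t, s ≤ m → t ≤ m → s ≠ t → f s ≠ f t := fun s t hs ht hst he =>
    hst (h.1.1 s t hs ht he)
  have asucc : ∀ s, s < m → G.Adj (f s) (f (s + 1)) := h.1.2
  have apred : ∀ s, 0 < s → s ≤ m → G.Adj (f s) (f (s - 1)) := fun s hs hsm => by
    have := h.1.2 (s - 1) (by omega)
    rw [show s - 1 + 1 = s by omega] at this
    exact this.symm
  have hrev : IsLongestPathMap G (fun t => f (m - t)) m := ⟨h.1.reverse, h.2⟩
  obtain ⟨z, hz, hz'⟩ := exists_adj_notMem (G := G) (v := f 0) {f 1} (by simp [h0])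
  obtain ⟨j, hj, rfl⟩ := h.exists_eq_of_adj hz
  obtain ⟨w, hw, hw'⟩ := exists_adj_notMem (G := G) (v := f m) {f (m - 1)} (by simp [hfm])
  obtain ⟨i', hi', rfl⟩ := hrev.exists_eq_of_adj (by simpa using hw)
  obtain ⟨i, hi, rfl⟩ : ∃ i, i ≤ m ∧ i' = m - i := ⟨m - i', by omega, by omega⟩
  simp only [show m - (m - i) = i by omega] at hw hw'
  have hj0 : j ≠ 0 := fun he => hz.ne (by rw [he])
  have hj1 : j ≠ 1 := fun he => hz' (by simp [he])
  have hjm : j ≠ m := fun he => hadj (he ▸ hz.symm)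
  have him : i ≠ m := fun he => hw.ne (by rw [he])
  have him1 : i ≠ m - 1 := fun he => hw' (by simp [he])
  have hi0 : i ≠ 0 := fun he => hadj (he ▸ hw)
  have a1 : G.Adj (f 0) (f 1) := asucc 0 (by omega)
  have hij : i ≠ j := by
    rintro rfl
    have hcard : ({f (i - 1), f (i + 1), f 0, f m} : Finset V).card = 4 := by
      rw [Finset.card_insert_of_notMem, Finset.card_eq_three.2
        ⟨f (i + 1), f 0, f m, hne _ _ (by omega) (by omega) (by omega),
          hne _ _ (by omega) (by omega) (by omega), hne _ _ (by omega) (by omega) (by omega), rfl⟩]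
      simp only [Finset.mem_insert, Finset.mem_singleton, not_or]
      exact ⟨hne _ _ (by omega) (by omega) (by omega), hne _ _ (by omega) (by omega) (by omega),
        hne _ _ (by omega) (by omega) (by omega)⟩
    have := card_le_degR (G := G) (v := f i) {f (i - 1), f (i + 1), f 0, f m} (by
      simp only [Finset.mem_insert, Finset.mem_singleton, forall_eq_or_imp, forall_eq]
      exact ⟨apred i (by omega) hi, asucc i (by omega), hz.symm, hw.symm⟩)
    have := hle (f i)
    omega
  have di : degR G (f i) = 3 := le_antisymm (hle _) (three_le_degR (apred i (by omega) hi)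
    (asucc i (by omega)) hw.symm (hne _ _ (by omega) (by omega) (by omega))
    (hne _ _ (by omega) (by omega) (by omega)) (hne _ _ (by omega) (by omega) (by omega)))
  have dj : degR G (f j) = 3 := le_antisymm (hle _) (three_le_degR (apred j (by omega) hj)
    (asucc j (by omega)) hz.symm (hne _ _ (by omega) (by omega) (by omega))
    (hne _ _ (by omega) (by omega) (by omega)) (hne _ _ (by omega) (by omega) (by omega)))
  have hxy : ∀ v, degR G v = 3 → v = x ∨ v = y := fun v hv => by
    by_contra! hc
    rw [h2 v hc.1 hc.2] at hv
    omega
  have hfij : f i ≠ f j := hne _ _ hi hj hij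
  have d2 : ∀ v, v ≠ f i → v ≠ f j → degR G v = 2 := by
    intro v hvi hvj
    have e1 := hxy _ di
    have e2 := hxy _ dj
    apply h2 <;> rintro rfl <;> rcases e1 with e1 | e1 <;> rcases e2 with e2 | e2 <;> grind
  have hnbr : ∀ s z, s ≤ m → (G.Adj (f s) z ↔ ∃ t, t ≤ m ∧ z = f t ∧ (t = s + 1 ∨ s = t + 1 ∨
      (s = 0 ∧ t = j) ∨ (s = j ∧ t = 0) ∨ (s = m ∧ t = i) ∨ (s = i ∧ t = m))) := by
    intro s z hs
    have three : ∀ t, t ≤ m → G.Adj (f s) (f t) → t ≠ s - 1 → t ≠ s + 1 → 0 < s → s < m →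
        degR G (f s) = 3 → (G.Adj (f s) z ↔ z = f (s - 1) ∨ z = f (s + 1) ∨ z = f t) :=
      fun t ht hst h1 h2 h3 h4 hd => adj_iff_of_degR_three hd (apred s h3 hs) (asucc s h4) hst
        (hne _ _ (by omega) (by omega) (by omega)) (hne _ _ (by omega) (by omega) (by omega))
        (hne _ _ (by omega) (by omega) (by omega)) z
    by_cases s0 : s = 0
    · subst s0
      rw [adj_iff_of_degR_two h0 a1 hz (hne _ _ (by omega) (by omega) (by omega))]
      constructor
      · rintro (rfl | rfl)
        exacts [⟨1, by omega, rfl, by omega⟩, ⟨j, by omega, rfl, by omega⟩]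
      · rintro ⟨t, ht, rfl, h'⟩
        rcases (by omega : t = 1 ∨ t = j) with rfl | rfl <;> simp
    by_cases sm : s = m
    · subst sm
      rw [adj_iff_of_degR_two hfm (apred s (by omega) le_rfl) hw
        (hne _ _ (by omega) (by omega) (by omega))]
      constructor
      · rintro (rfl | rfl)
        exacts [⟨s - 1, by omega, rfl, by omega⟩, ⟨i, by omega, rfl, by omega⟩]
      · rintro ⟨t, ht, rfl, h'⟩
        rcases (by omega : t = s - 1 ∨ t = i) with rfl | rfl <;> simp
    by_cases si : s = i
    · subst si
      rw [three m le_rfl hw.symm (by omega) (by omega) (by omega) (by omega) di]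
      constructor
      · rintro (rfl | rfl | rfl)
        exacts [⟨s - 1, by omega, rfl, by omega⟩, ⟨s + 1, by omega, rfl, by omega⟩,
          ⟨m, by omega, rfl, by omega⟩]
      · rintro ⟨t, ht, rfl, h'⟩
        rcases (by omega : t = s - 1 ∨ t = s + 1 ∨ t = m) with rfl | rfl | rfl <;> simp
    by_cases sj : s = j
    · subst sj
      rw [three 0 (by omega) hz.symm (by omega) (by omega) (by omega) (by omega) dj]
      constructor
      · rintro (rfl | rfl | rfl)
        exacts [⟨s - 1, by omega, rfl, by omega⟩, ⟨s + 1, by omega, rfl, by omega⟩,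
          ⟨0, by omega, rfl, by omega⟩]
      · rintro ⟨t, ht, rfl, h'⟩
        rcases (by omega : t = s - 1 ∨ t = s + 1 ∨ t = 0) with rfl | rfl | rfl <;> simp
    · rw [adj_iff_of_degR_two (d2 _ (hne _ _ hs hi si) (hne _ _ hs hj sj))
        (apred s (by omega) hs) (asucc s (by omega)) (hne _ _ (by omega) (by omega) (by omega))]
      constructor
      · rintro (rfl | rfl)
        exacts [⟨s - 1, by omega, rfl, by omega⟩, ⟨s + 1, by omega, rfl, by omega⟩]
      · rintro ⟨t, ht, rfl, h'⟩
        rcases (by omega : t = s - 1 ∨ t = s + 1) with rfl | rfl <;> simp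
  refine ⟨i, j, hij, by omega, by omega, by omega, by omega, h.1.1,
    exists_eq_of_closed hconn fun s z hs hsz => ?_, fun s t hs ht => ?_⟩
  · obtain ⟨t, ht, hzt, -⟩ := (hnbr s z hs).1 hsz
    exact ⟨t, ht, hzt⟩
  · rw [hnbr s _ hs]
    constructor
    · rintro ⟨t', ht', he, h'⟩
      rw [h.1.1 _ _ ht ht' he]
      exact h'
    · intro h'
      exact ⟨t, ht, rfl, h'⟩

lemma card_eq_of_isPathMap (inj : ∀ s t, s ≤ m → t ≤ m → f s = f t → s = t)
    (surj : ∀ z, ∃ t, t ≤ m ∧ z = f t) : m + 1 = Fintype.card V := by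
  rw [← Fintype.card_fin (m + 1)]
  refine Fintype.card_of_bijective (f := fun t : Fin (m + 1) => f t)
    ⟨fun s t hst => Fin.ext (inj _ _ (by omega) (by omega) hst), fun z => ?_⟩
  obtain ⟨t, ht, rfl⟩ := surj z
  exact ⟨⟨t, by omega⟩, rfl⟩

/-- A graph whose degrees are two except for two vertices of degree three, in which two cycles
share an edge, is a theta graph. -/
lemma isB3a_or_isB3b (hconn : G.Connected) {x y : V} (hx : degR G x = 3) (hy : degR G y = 3)
    (h2 : ∀ v, v ≠ x → v ≠ y → degR G v = 2) {C C' : V → V → Prop} (hC : IsCycleRel G C)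
    (hC' : IsCycleRel G C') {v w : V} (hvw : C v w) (hvw' : C' v w)
    (hdiff : ∃ a b, ¬ (C a b ↔ C' a b)) :
    IsB3a (Fintype.card V) G ∨ IsB3b (Fintype.card V) G := by
  have hdeg : ∀ v, 2 ≤ degR G v ∧ degR G v ≤ 3 := fun v => by
    by_cases h1 : v = x
    · subst h1; omega
    · by_cases h3 : v = y
      · subst h3; omega
      · rw [h2 v h1 h3]; omega
  obtain ⟨f, m, h, h0, hfm⟩ := exists_isLongestPathMap_ends ⟨x⟩ (fun v => (hdeg v).1) h2
  have hm := h.two_le fun v => (hdeg v).1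
  by_cases hadj : G.Adj (f m) (f 0)
  · rw [← card_eq_of_isPathMap h.1.1 (h.exists_eq_of_cyclic hconn hadj)]
    exact Or.inl (h.isB3a_of_cyclic hconn hm hadj hx hy h2)
  · obtain ⟨i, j, hij, hi, him, hj, hjm, hP⟩ := h.exists_isPathWithChords hconn hm hadj h0 hfm
      (fun v => (hdeg v).2) h2
    rw [← card_eq_of_isPathMap hP.inj hP.surj]
    rcases (by omega : j = i + 1 ∨ i + 2 ≤ j ∨ j < i) with rfl | hlt | hlt
    · exact Or.inl (hP.isB3a hi him)
    · exact Or.inr (hP.isB3b hi hlt hjm)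
    · obtain ⟨a, b, hab⟩ := hdiff
      exact absurd (hC.eq_of_dumbbell hC' hP hj hlt him hvw hvw' a b) hab

end Structure

section Values

variable {V W : Type*} [Fintype V] {G : SimpleGraph V} {H : SimpleGraph W}

open Classical in
lemma sumConn_of_iso (φ : G ≃g H) (hedges : G.edgeSet.ncard = Fintype.card V + 1) {x y : W}
    (hxy : x ≠ y) (htwo : ∀ s, ∃ a b, a ≠ b ∧ H.Adj s a ∧ H.Adj s b)
    (hx : ∃ a b c, a ≠ b ∧ a ≠ c ∧ b ≠ c ∧ H.Adj x a ∧ H.Adj x b ∧ H.Adj x c)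
    (hy : ∃ a b c, a ≠ b ∧ a ≠ c ∧ b ≠ c ∧ H.Adj y a ∧ H.Adj y b ∧ H.Adj y c) :
    sumConn G = ((Fintype.card V : ℝ) - 5) / 2 + 6 / √5 +
      if H.Adj x y then 1 / 2 + 1 / √6 - 2 / √5 else 0 := by
  have inj := φ.symm.injective
  have hadj : ∀ {s t}, H.Adj s t → G.Adj (φ.symm s) (φ.symm t) := φ.symm.map_adj_iff.2
  have three : ∀ x, (∃ a b c, a ≠ b ∧ a ≠ c ∧ b ≠ c ∧ H.Adj x a ∧ H.Adj x b ∧ H.Adj x c) →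
      3 ≤ degR G (φ.symm x) := by
    rintro x ⟨a, b, c, hab, hac, hbc, ha, hb, hc⟩
    exact three_le_degR (hadj ha) (hadj hb) (hadj hc) (inj.ne hab) (inj.ne hac) (inj.ne hbc)
  have hge : ∀ v, 2 ≤ degR G v := by
    intro v
    obtain ⟨s, rfl⟩ := φ.symm.surjective v
    obtain ⟨a, b, hab, ha, hb⟩ := htwo s
    exact two_le_degR (hadj ha) (hadj hb) (inj.ne hab)
  obtain ⟨h3x, h3y, h2⟩ := degR_eq_of_three_le hge hedges (inj.ne hxy) (three x hx) (three y hy)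
  rw [sumConn_of_two_cubic hedges (inj.ne hxy) h3x h3y h2]
  simp only [φ.symm.map_adj_iff]

lemma exists_cycleGraph_neighbors {n : ℕ} (hn : 3 ≤ n) (s : Fin n) :
    ∃ a b, a ≠ b ∧ (cycleGraph n).Adj s a ∧ (cycleGraph n).Adj s b := by
  have hs := s.2
  simp only [cycleGraph_adj_iff_val hn, Ne, Fin.ext_iff]
  refine ⟨⟨if s.val + 1 = n then 0 else s + 1, by split_ifs <;> omega⟩,
    ⟨if s.val = 0 then n - 1 else s - 1, by split_ifs <;> omega⟩, ?_, ?_, ?_⟩ <;>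
  dsimp only <;> split_ifs <;> omega

lemma IsB3a.sumConn_eq (hedges : G.edgeSet.ncard = Fintype.card V + 1)
    (h : IsB3a (Fintype.card V) G) (hn : 3 ≤ Fintype.card V) :
    sumConn G = ((Fintype.card V : ℝ) - 4) / 2 + 1 / √6 + 4 / √5 := by
  classical
  obtain ⟨x, y, hxy, hnadj, ⟨φ⟩⟩ := h
  have hadj : (cycleGraph (Fintype.card V) ⊔ fromEdgeSet {s(x, y)}).Adj x y := by simp [hxy]
  rw [sumConn_of_iso φ hedges hxy, if_pos hadj]
  · ring
  · intro s
    obtain ⟨a, b, hab, ha, hb⟩ := exists_cycleGraph_neighbors hn s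
    exact ⟨a, b, hab, Or.inl ha, Or.inl hb⟩
  · obtain ⟨a, b, hab, ha, hb⟩ := exists_cycleGraph_neighbors hn x
    exact ⟨a, b, y, hab, fun he => hnadj (he ▸ ha), fun he => hnadj (he ▸ hb), Or.inl ha,
      Or.inl hb, hadj⟩
  · obtain ⟨a, b, hab, ha, hb⟩ := exists_cycleGraph_neighbors hn y
    exact ⟨a, b, x, hab, fun he => hnadj (he ▸ ha).symm, fun he => hnadj (he ▸ hb).symm, Or.inl ha,
      Or.inl hb, hadj.symm⟩

lemma IsB3b.sumConn_eq (hedges : G.edgeSet.ncard = Fintype.card V + 1)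
    (h : IsB3b (Fintype.card V) G) :
    sumConn G = ((Fintype.card V : ℝ) - 5) / 2 + 6 / √5 := by
  classical
  obtain ⟨a, x, y, ha, han, hxy, hnadj, ⟨φ⟩⟩ := h
  have hcyc : ∀ s : Fin a, ∃ c d, c ≠ d ∧
      (cyclePlusPath a (Fintype.card V - a) x y).Adj (Sum.inl s) (Sum.inl c) ∧
      (cyclePlusPath a (Fintype.card V - a) x y).Adj (Sum.inl s) (Sum.inl d) := fun s => by
    simpa only [cyclePlusPath_adj_inl_inl] using exists_cycleGraph_neighbors (by omega) s
  have hk : 0 < Fintype.card V - a := by omega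
  generalize Fintype.card V - a = k at φ hcyc hk
  have three : ∀ (s : Fin a) (t : Fin k), (cyclePlusPath a k x y).Adj (Sum.inl s) (Sum.inr t) →
      ∃ b c d, b ≠ c ∧ b ≠ d ∧ c ≠ d ∧ (cyclePlusPath a k x y).Adj (Sum.inl s) b ∧
        (cyclePlusPath a k x y).Adj (Sum.inl s) c ∧ (cyclePlusPath a k x y).Adj (Sum.inl s) d := by
    intro s t h
    obtain ⟨c, d, hcd, hc, hd⟩ := hcyc s
    exact ⟨_, _, _, Sum.inl_injective.ne hcd, Sum.inl_ne_inr, Sum.inl_ne_inr, hc, hd, h⟩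
  rw [sumConn_of_iso φ hedges (Sum.inl_injective.ne hxy),
    if_neg (cyclePlusPath_adj_inl_inl.not.2 hnadj), add_zero]
  · rintro (s | t)
    · obtain ⟨c, d, hcd, hc, hd⟩ := hcyc s
      exact ⟨_, _, Sum.inl_injective.ne hcd, hc, hd⟩
    · have ht := t.2
      have hx0 : t.val = 0 → (cyclePlusPath a k x y).Adj (Sum.inr t) (Sum.inl x) := fun h0 =>
        (cyclePlusPath_adj_inl_inr.2 (Or.inl ⟨rfl, h0⟩)).symm
      have hyk : t.val + 1 = k → (cyclePlusPath a k x y).Adj (Sum.inr t) (Sum.inl y) := fun h0 =>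
        (cyclePlusPath_adj_inl_inr.2 (Or.inr ⟨rfl, h0⟩)).symm
      by_cases h0 : t.val = 0 <;> by_cases h1 : t.val + 1 = k
      · exact ⟨_, _, Sum.inl_injective.ne hxy, hx0 h0, hyk h1⟩
      · exact ⟨_, Sum.inr ⟨t + 1, by omega⟩, Sum.inl_ne_inr, hx0 h0,
          cyclePlusPath_adj_inr_inr.2 (Or.inl rfl)⟩
      · exact ⟨_, Sum.inr ⟨t - 1, by omega⟩, Sum.inl_ne_inr, hyk h1,
          cyclePlusPath_adj_inr_inr.2 (Or.inr (show t.val = t.val - 1 + 1 by omega))⟩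
      · refine ⟨Sum.inr ⟨t + 1, by omega⟩, Sum.inr ⟨t - 1, by omega⟩, ?_,
          cyclePlusPath_adj_inr_inr.2 (Or.inl rfl),
          cyclePlusPath_adj_inr_inr.2 (Or.inr (show t.val = t.val - 1 + 1 by omega))⟩
        simp only [Ne, Sum.inr.injEq, Fin.ext_iff]
        omega
  · exact three x ⟨0, hk⟩ (cyclePlusPath_adj_inl_inr.2 (Or.inl ⟨rfl, rfl⟩))
  · exact three y ⟨k - 1, by omega⟩
      (cyclePlusPath_adj_inl_inr.2 (Or.inr ⟨rfl, show k - 1 + 1 = k by omega⟩))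

/-- A version of `isB3a_or_isB3b` for two cycles given as closed walks. -/
lemma isB3a_or_isB3b_of_isCycle (hconn : G.Connected) {x y : V} (hx : degR G x = 3)
    (hy : degR G y = 3) (h2 : ∀ v, v ≠ x → v ≠ y → degR G v = 2) {u v : V} {c₁ : G.Walk u u}
    {c₂ : G.Walk v v} (hc₁ : c₁.IsCycle) (hc₂ : c₂.IsCycle)
    (hne : {e | e ∈ c₁.edges} ≠ {e | e ∈ c₂.edges}) {e : Sym2 V} (he₁ : e ∈ c₁.edges)
    (he₂ : e ∈ c₂.edges) : IsB3a (Fintype.card V) G ∨ IsB3b (Fintype.card V) G := by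
  induction e with | _ p q
  refine isB3a_or_isB3b hconn hx hy h2 (isCycleRel_toSubgraph hc₁) (isCycleRel_toSubgraph hc₂)
    (v := p) (w := q) (c₁.adj_toSubgraph_iff_mem_edges.2 he₁)
    (c₂.adj_toSubgraph_iff_mem_edges.2 he₂) ?_
  by_contra! hall
  refine hne (Set.ext fun e => ?_)
  induction e with | _ a b
  simpa only [Walk.adj_toSubgraph_iff_mem_edges, Set.mem_ofPred_eq] using hall a b

end Values

/-- Let `n ≥ 5` and let `G` be a connected graph on `n` vertices whose cycles are
exactly two cycles sharing at least one common edge (so `G` is bicyclic, with `n + 1`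
edges, and contains two distinct cycles sharing an edge, i.e. `G ∈ 𝔹₃(n)`). Then
`χ(G) ≤ (n−4)/2 + 1/√6 + 4/√5`, with equality iff `G` is obtained from the cycle
`C_n` by adding an edge; moreover, if `G` is not of that form, then
`χ(G) ≤ (n−5)/2 + 6/√5`, with equality iff `G` is obtained by joining two
non-adjacent vertices of a cycle `C_a` with `4 ≤ a ≤ n−1` by a path of length
`n − a + 1`. -/
theorem stmt_17 {V : Type*} [Fintype V] (G : SimpleGraph V) (n : ℕ) (hn : 5 ≤ n)
    (hcard : Fintype.card V = n) (hconn : G.Connected)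
    (hedges : G.edgeSet.ncard = n + 1)
    (hshare : ∃ (u v : V) (c₁ : G.Walk u u) (c₂ : G.Walk v v),
      c₁.IsCycle ∧ c₂.IsCycle ∧ {e : Sym2 V | e ∈ c₁.edges} ≠ {e : Sym2 V | e ∈ c₂.edges} ∧
      ∃ e : Sym2 V, e ∈ c₁.edges ∧ e ∈ c₂.edges) :
    (sumConn G ≤ ((n : ℝ) - 4) / 2 + 1 / Real.sqrt 6 + 4 / Real.sqrt 5 ∧
      (sumConn G = ((n : ℝ) - 4) / 2 + 1 / Real.sqrt 6 + 4 / Real.sqrt 5 ↔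
        IsB3a n G)) ∧
    (¬ IsB3a n G →
      sumConn G ≤ ((n : ℝ) - 5) / 2 + 6 / Real.sqrt 5 ∧
      (sumConn G = ((n : ℝ) - 5) / 2 + 6 / Real.sqrt 5 ↔ IsB3b n G)) := by
  subst hcard
  have hlt := nonadjacent_bound_lt_adjacent_bound (Fintype.card V)
  have hcases : sumConn G < ((Fintype.card V : ℝ) - 5) / 2 + 6 / √5 ∨
      IsB3a (Fintype.card V) G ∨ IsB3b (Fintype.card V) G := by
    by_cases hleaf : ∃ v, degR G v = 1
    · obtain ⟨v, hv⟩ := hleaf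
      exact Or.inl (sumConn_lt_of_leaf hconn (by omega) hedges hv)
    · push Not at hleaf
      have hge : ∀ v, 2 ≤ degR G v := fun v => by
        have := degR_pos_of_connected hconn (by omega) v
        have := hleaf v
        omega
      rcases degR_cases hge hedges with ⟨x, hx, h2⟩ | ⟨x, y, -, hx, hy, h2⟩
      · exact Or.inl (sumConn_lt_of_degR_four hedges hx h2)
      · obtain ⟨u, v, c₁, c₂, hc₁, hc₂, hne, e, he₁, he₂⟩ := hshare
        exact Or.inr (isB3a_or_isB3b_of_isCycle hconn hx hy h2 hc₁ hc₂ hne he₁ he₂)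
  have hA : IsB3a (Fintype.card V) G → _ := fun h => h.sumConn_eq hedges (by omega)
  have hB : IsB3b (Fintype.card V) G → _ := fun h => h.sumConn_eq hedges
  refine ⟨⟨?_, fun he => ?_, hA⟩, fun hnA => ⟨?_, fun he => ?_, hB⟩⟩
  · rcases hcases with h | h | h
    · exact (h.trans hlt).le
    · exact (hA h).le
    · exact (hB h).le.trans hlt.le
  · rcases hcases with h | h | h
    · exact absurd he (h.trans hlt).ne
    · exact h
    · exact absurd he (hB h ▸ hlt.ne)
  · rcases hcases with h | h | h
    · exact h.le
    · exact absurd h hnA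
    · exact (hB h).le
  · rcases hcases with h | h | h
    · exact absurd he h.ne
    · exact absurd h hnA
    · exact h
end

section
/- For every integer m ≥ 3, one has m − 1 + 4/√6 > (m+1)/√(m+5) + 2/√(m+4) + (m−3)/√3 + 1. -/
/-- An affine upper bound for `x ↦ (x + 1) / √(x + 5)` on `[3, ∞)`. -/
theorem add_one_div_sqrt_add_five_le {x : ℝ} (hx : 3 ≤ x) :
    (x + 1) / Real.sqrt (x + 5) ≤ 3 / 2 + 2 / 5 * (x - 3) := by
  have hs : (14 / 5 : ℝ) ≤ Real.sqrt (x + 5) := Real.le_sqrt_of_sq_le (by linarith)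
  have hsq : Real.sqrt (x + 5) ^ 2 = x + 5 := Real.sq_sqrt (by linarith)
  generalize Real.sqrt (x + 5) = s at hs hsq ⊢
  obtain rfl : x = s ^ 2 - 5 := by linarith
  rw [div_le_iff₀ (by linarith)]
  nlinarith [mul_nonneg (sub_nonneg.2 hs) (sq_nonneg (s - 14 / 5)), sq_nonneg (s - 14 / 5)]

/-- For every integer `m ≥ 3`,
`m − 1 + 4/√6 > (m+1)/√(m+5) + 2/√(m+4) + (m−3)/√3 + 1`. -/
theorem stmt_19 (m : ℤ) (hm : 3 ≤ m) :
    (m : ℝ) - 1 + 4 / Real.sqrt 6 >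
      ((m : ℝ) + 1) / Real.sqrt ((m : ℝ) + 5) + 2 / Real.sqrt ((m : ℝ) + 4) +
        ((m : ℝ) - 3) / Real.sqrt 3 + 1 := by
  have hx : (3 : ℝ) ≤ m := by exact_mod_cast hm
  have h₁ := add_one_div_sqrt_add_five_le hx
  have h₂ : 2 / Real.sqrt ((m : ℝ) + 4) ≤ 4 / 5 := by
    have : (5 / 2 : ℝ) ≤ Real.sqrt (m + 4) := Real.le_sqrt_of_sq_le (by linarith)
    rw [div_le_iff₀ (by linarith)]
    linarith
  have h₃ : ((m : ℝ) - 3) / Real.sqrt 3 ≤ 3 / 5 * (m - 3) := by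
    have : (5 / 3 : ℝ) ≤ Real.sqrt 3 := Real.le_sqrt_of_sq_le (by norm_num)
    rw [div_le_iff₀ (by linarith)]
    nlinarith
  have h₄ : 8 / 5 ≤ 4 / Real.sqrt 6 := by
    have : Real.sqrt 6 ≤ 5 / 2 := Real.sqrt_le_iff.2 (by norm_num)
    rw [le_div_iff₀ (by positivity)]
    linarith
  linarith
end
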